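/- Let F/K be a finite Galois extension of number fields with Galois group G, let μ_F be the group of roots of unity of F, and let Cl_F be the ideal class group of O_F. Then the equality [Ar_F] = σ[O_F^×/μ_F] − σ[Cl_F] holds in G₀(ℤ[G]). -/

import Mathlib

/-- A bundled finitely generated module over a ring `R`. -/
structure FGMod (R : Type) [Ring R] : Type 1 where
  carrier : Type
  [isAddCommGroup : AddCommGroup carrier]
  [isModule : Module R carrier]
  [isFinite : Module.Finite R carrier]

attribute [instance] FGMod.isAddCommGroup FGMod.isModule FGMod.isFinite

/-- The subgroup of relations defining the Grothendieck group `G₀(R)`: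
one relation `[M] = [L] + [N]` for each short exact sequence `0 → L → M → N → 0`
of finitely generated `R`-modules. -/
def G0Rel (R : Type) [Ring R] : AddSubgroup (FreeAbelianGroup (FGMod R)) :=
  AddSubgroup.closure
    { x | ∃ (L M N : FGMod R) (f : L.carrier →ₗ[R] M.carrier)
            (g : M.carrier →ₗ[R] N.carrier),
        Function.Injective f ∧ Function.Surjective g ∧ Function.Exact f g ∧
        x = FreeAbelianGroup.of M - FreeAbelianGroup.of L - FreeAbelianGroup.of N }

/-- The Grothendieck group `G₀(R)` of the category of finitely generated `R`-modules. -/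
def G0 (R : Type) [Ring R] : Type 1 :=
  FreeAbelianGroup (FGMod R) ⧸ G0Rel R

instance (R : Type) [Ring R] : AddCommGroup (G0 R) :=
  QuotientAddGroup.Quotient.addCommGroup _

/-- The class `[M] ∈ G₀(R)` of a finitely generated `R`-module `M` (junk value `0` if `M` is
not finitely generated). -/
noncomputable def G0.cls (R : Type) [Ring R] (M : Type) [AddCommGroup M] [Module R M] :
    G0 R := by
  classical
  exact
    if h : Module.Finite R M then
      QuotientAddGroup.mk (FreeAbelianGroup.of (@FGMod.mk R _ M _ _ h))
    else 0

open NumberField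
open scoped nonZeroDivisors TensorProduct

noncomputable section

variable (F : Type) [Field F] [NumberField F]

/-- The étale ℝ-algebra F_ℝ = F ⊗_ℚ ℝ. -/
abbrev FReal := ℝ ⊗[ℚ] F

/-- The canonical (finite-dimensional real vector space) topology on F_ℝ. -/
instance : TopologicalSpace (FReal F) :=
  TopologicalSpace.induced (Module.finBasis ℝ (FReal F)).equivFun inferInstance

/-- The group of fractional ideals of F. -/
abbrev IdealGroup := (FractionalIdeal (𝓞 F)⁰ F)ˣ

/-- The group of fractional ideals carries the discrete topology. -/
instance : TopologicalSpace (IdealGroup F) := ⊥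

/-- The ideal norm, as a group homomorphism to ℝˣ. -/
def idealNormHom : IdealGroup F →* ℝˣ :=
  (Units.map (Rat.castHom ℝ).toMonoidHom).comp
    (Units.map (FractionalIdeal.absNorm (R := 𝓞 F) (K := F)).toMonoidHom)

/-- The absolute value of the algebra norm on F_ℝˣ, as a group homomorphism to ℝˣ. -/
def absNormFR : (FReal F)ˣ →* ℝˣ :=
  (Units.map (absHom (α := ℝ)).toMonoidHom).comp (Units.map (Algebra.norm ℝ (S := FReal F)))

/-- The fibre product Id_F ×_{ℝ>0} F_ℝˣ, i.e. the subgroup of pairs (I, b) with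
N(I) = |Nm(b)|, formalized as the kernel of the quotient of the two norm maps. -/
def picDom : Subgroup (IdealGroup F × (FReal F)ˣ) :=
  MonoidHom.ker (((idealNormHom F).comp (MonoidHom.fst _ _)) /
    ((absNormFR F).comp (MonoidHom.snd _ _)))

/-- The map F^× → Id_F ×_{ℝ>0} F_ℝˣ, α ↦ (αO_F, α ⊗ 1). -/
def principalHom : Fˣ →* IdealGroup F × (FReal F)ˣ :=
  (toPrincipalIdeal (𝓞 F) F).prod
    (Units.map (Algebra.TensorProduct.includeRight : F →ₐ[ℚ] FReal F).toMonoidHom)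

/-- The subgroup of the fibre product coming from principal oriented Arakelov divisors. -/
def principalSub : Subgroup (picDom F) :=
  Subgroup.comap (picDom F).subtype (MonoidHom.range (principalHom F))

/-- The oriented Arakelov class group of F: the cokernel of F^× → Id_F ×_{ℝ>0} F_ℝˣ. -/
def PicTilde := picDom F ⧸ principalSub F

instance : CommGroup (PicTilde F) := QuotientGroup.Quotient.commGroup _
instance : TopologicalSpace (PicTilde F) := instTopologicalSpaceQuotient

/-- The class of an oriented Arakelov divisor in the oriented Arakelov class group. -/
def PicTilde.mk : picDom F → PicTilde F := QuotientGroup.mk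

/-- The maximal compact subgroup comp(F_ℝˣ) of F_ℝˣ: the subgroup generated by all
compact subgroups. -/
def maxCompact : Subgroup (FReal F)ˣ :=
  sSup { H : Subgroup (FReal F)ˣ | IsCompact (H : Set (FReal F)ˣ) }

/-- The image of {1} × comp(F_ℝˣ) in the oriented Arakelov class group. -/
def compImage : Subgroup (PicTilde F) :=
  Subgroup.map (QuotientGroup.mk' (principalSub F))
    (Subgroup.comap (picDom F).subtype ((⊥ : Subgroup (IdealGroup F)).prod (maxCompact F)))

/-- The Arakelov class group of F: the quotient of the oriented Arakelov class group by
the image of {1} × comp(F_ℝˣ). -/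
def PicZero := PicTilde F ⧸ compImage F

instance : CommGroup (PicZero F) := QuotientGroup.Quotient.commGroup _
instance : TopologicalSpace (PicZero F) := instTopologicalSpaceQuotient

/-- The class of an oriented Arakelov divisor in the Arakelov class group. -/
def PicZero.mk : picDom F → PicZero F := fun x => QuotientGroup.mk (PicTilde.mk F x)

/-- ℝ/ℤ. -/
abbrev RmodZ := AddCircle (1 : ℝ)

/-- The Pontryagin dual Ãr_F of the oriented Arakelov class group: the group of
continuous homomorphisms to ℝ/ℤ. -/
def ArTilde := ContinuousAddMonoidHom (Additive (PicTilde F)) RmodZ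

instance : AddCommGroup (ArTilde F) := by unfold ArTilde; infer_instance
instance : FunLike (ArTilde F) (Additive (PicTilde F)) RmodZ := by unfold ArTilde; infer_instance

/-- The Pontryagin dual Ar_F of the Arakelov class group. -/
def ArF := ContinuousAddMonoidHom (Additive (PicZero F)) RmodZ

instance : AddCommGroup (ArF F) := by unfold ArF; infer_instance
instance : FunLike (ArF F) (Additive (PicZero F)) RmodZ := by unfold ArF; infer_instance

/-- ℚ/ℤ as a ℤ-module. -/
abbrev QmodZ := ℚ ⧸ (Submodule.span ℤ {(1 : ℚ)})

variable {F} in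
/-- The automorphism of F_ℝ = ℝ ⊗_ℚ F induced by an automorphism of F over a subfield K. -/
def galFReal (K : Type) [Field K] [CharZero K] [Algebra K F] (g : F ≃ₐ[K] F) : FReal F ≃ₐ[ℚ] FReal F :=
  Algebra.TensorProduct.congr AlgEquiv.refl (g.restrictScalars ℚ)

end


/-! ### The Grothendieck group -/

/-- The quotient map onto `G₀(R)`. -/
noncomputable def G0.quot (R : Type) [Ring R] : FreeAbelianGroup (FGMod R) →+ G0 R :=
  QuotientAddGroup.mk' (G0Rel R)

theorem G0.cls_of_finite (R : Type) [Ring R] (M : Type) [AddCommGroup M] [Module R M]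
    [h : Module.Finite R M] : G0.cls R M = G0.quot R (FreeAbelianGroup.of (FGMod.mk M)) :=
  dif_pos h

/-- Additivity of classes in `G₀` on short exact sequences. -/
theorem G0.cls_eq_add_of_exact {R : Type} [Ring R] {L M N : Type} [AddCommGroup L] [Module R L]
    [AddCommGroup M] [Module R M] [AddCommGroup N] [Module R N]
    [Module.Finite R L] [Module.Finite R N] (f : L →ₗ[R] M) (g : M →ₗ[R] N)
    (hf : Function.Injective f) (hg : Function.Surjective g) (hfg : Function.Exact f g) :
    G0.cls R M = G0.cls R L + G0.cls R N := by
  have hM : Module.Finite R M := .of_exact hfg hg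
  rw [G0.cls_of_finite, G0.cls_of_finite, G0.cls_of_finite, ← sub_eq_zero, ← sub_sub,
    ← map_sub, ← map_sub]
  refine (QuotientAddGroup.eq_zero_iff _).2 (AddSubgroup.subset_closure ?_)
  exact ⟨⟨L⟩, ⟨M⟩, ⟨N⟩, f, g, hf, hg, hfg, rfl⟩

/-! ### Modules over integral group rings -/

/-- An additive map commuting with the action of group elements is `ℤ[G]`-linear. -/
noncomputable def AddMonoidHom.toGroupRingLinearMap {G M N : Type} [Group G] [AddCommGroup M]
    [AddCommGroup N] [Module (MonoidAlgebra ℤ G) M] [Module (MonoidAlgebra ℤ G) N] (f : M →+ N)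
    (hf : ∀ (g : G) (x : M), f ((MonoidAlgebra.single g (1 : ℤ) : MonoidAlgebra ℤ G) • x) =
      (MonoidAlgebra.single g (1 : ℤ) : MonoidAlgebra ℤ G) • f x) :
    M →ₗ[MonoidAlgebra ℤ G] N :=
  { f with
    map_smul' := fun r x => by
      induction r using MonoidAlgebra.induction_on with
      | of g => exact hf g x
      | add a b ha hb => simp_all [add_smul]
      | smul n a ha => 
        simp only [smul_assoc, ZeroHom.toFun_eq_coe, AddMonoidHom.toZeroHom_coe, map_zsmul,
          RingHom.id_apply] at ha ⊢
        rw [ha] }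

/-- The action of a group element on a `ℤ[G]`-module, as a `ℤ`-linear endomorphism. -/
noncomputable def groupRingAct {G M : Type} [Group G] [AddCommGroup M] [Module (MonoidAlgebra ℤ G) M] :
    G →* Module.End ℤ M where
  toFun g := (DistribSMul.toAddMonoidHom M
    (MonoidAlgebra.single g (1 : ℤ) : MonoidAlgebra ℤ G)).toIntLinearMap
  map_one' := by
    ext x
    exact one_smul (MonoidAlgebra ℤ G) x
  map_mul' g h := by
    ext x
    change MonoidAlgebra.single (g * h) (1 : ℤ) • x =
      MonoidAlgebra.single g (1 : ℤ) • MonoidAlgebra.single h (1 : ℤ) • x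
    rw [smul_smul, MonoidAlgebra.single_mul_single, one_mul]

/-- The contragredient action of a group on the homomorphisms from a `ℤ[G]`-module to an
abelian group. -/
noncomputable def contragredientAct (G M A : Type) [Group G] [AddCommGroup M] [Module (MonoidAlgebra ℤ G) M]
    [AddCommGroup A] [Module ℤ A] : G →* Module.End ℤ (M →ₗ[ℤ] A) where
  toFun g :=
    { toFun := fun φ => φ ∘ₗ groupRingAct g⁻¹
      map_add' := fun _ _ => rfl
      map_smul' := fun _ _ => rfl }
  map_one' := by
    ext φ x
    simp
  map_mul' g h := by
    ext φ x
    simp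

/-- The contragredient `ℤ[G]`-module structure. -/
@[reducible] noncomputable def contragredientModule (G M A : Type) [Group G] [AddCommGroup M]
    [Module (MonoidAlgebra ℤ G) M] [AddCommGroup A] [Module ℤ A] :
    Module (MonoidAlgebra ℤ G) (M →ₗ[ℤ] A) :=
  Module.compHom (M →ₗ[ℤ] A)
    (MonoidAlgebra.lift ℤ (Module.End ℤ (M →ₗ[ℤ] A)) G (contragredientAct G M A)).toRingHom

theorem contragredientModule_smul_apply {G M A : Type} [Group G] [AddCommGroup M]
    [Module (MonoidAlgebra ℤ G) M] [AddCommGroup A] [Module ℤ A] (g : G) (φ : M →ₗ[ℤ] A) (x : M) :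
    letI := contragredientModule G M A
    ((MonoidAlgebra.single g (1 : ℤ) : MonoidAlgebra ℤ G) • φ) x =
      φ ((MonoidAlgebra.single g⁻¹ (1 : ℤ) : MonoidAlgebra ℤ G) • x) := by
  change (MonoidAlgebra.lift ℤ (Module.End ℤ (M →ₗ[ℤ] A)) G (contragredientAct G M A)
    (MonoidAlgebra.single g (1 : ℤ))) φ x = _
  rw [MonoidAlgebra.lift_single, one_smul]
  rfl

theorem groupRing_finite_of_int {G M : Type} [Group G] [AddCommGroup M]
    [Module (MonoidAlgebra ℤ G) M] [Module.Finite ℤ M] : Module.Finite (MonoidAlgebra ℤ G) M :=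
  Module.Finite.of_restrictScalars_finite ℤ (MonoidAlgebra ℤ G) M

/-! ### Homomorphisms to divisible groups and to `ℚ/ℤ` -/

/-- A homomorphism to a divisible group extends along any homomorphism whose kernel it kills. -/
theorem exists_extension_of_divisible {A B D : Type} [AddCommGroup A] [AddCommGroup B]
    [AddCommGroup D] [DivisibleBy D ℤ] (j : A →+ B) (f : A →+ D) (h : j.ker ≤ f.ker) :
    ∃ F : B →+ D, ∀ a, F (j a) = f a := by
  obtain ⟨F, hF⟩ := (Module.Baer.of_divisible D).extension_property_addMonoidHom
    (QuotientAddGroup.kerLift j) (QuotientAddGroup.kerLift_injective j)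
    (QuotientAddGroup.lift j.ker f h)
  exact ⟨F, fun a => DFunLike.congr_fun hF (QuotientAddGroup.mk a)⟩

/-- The embedding of `ℚ/ℤ` in `ℝ/ℤ`. -/
noncomputable def qmodzToRmodZ : QmodZ →ₗ[ℤ] RmodZ :=
  Submodule.liftQ _ ((QuotientAddGroup.mk' (AddSubgroup.zmultiples (1 : ℝ))).comp
      (Rat.castHom ℝ).toAddMonoidHom).toIntLinearMap <| by
    rw [Submodule.span_singleton_le_iff_mem]
    change ((((1 : ℚ) : ℝ)) : RmodZ) = 0
    rw [Rat.cast_one]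
    exact AddCircle.coe_period 1

theorem qmodzToRmodZ_mk (q : ℚ) :
    qmodzToRmodZ (Submodule.Quotient.mk q) = (((q : ℝ)) : RmodZ) := rfl

theorem qmodzToRmodZ_injective : Function.Injective qmodzToRmodZ := by
  rw [injective_iff_map_eq_zero]
  intro x hx
  obtain ⟨q, rfl⟩ := Submodule.Quotient.mk_surjective _ x
  rw [qmodzToRmodZ_mk, AddCircle.coe_eq_zero_iff] at hx
  obtain ⟨n, hn⟩ := hx
  rw [Submodule.Quotient.mk_eq_zero, Submodule.mem_span_singleton]
  refine ⟨n, ?_⟩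
  have : ((n : ℚ) : ℝ) = q := by simpa using hn
  simpa using Rat.cast_injective this

theorem mem_range_qmodzToRmodZ {x : RmodZ} {n : ℕ} (hn : n ≠ 0) (hx : n • x = 0) :
    x ∈ LinearMap.range qmodzToRmodZ := by
  obtain ⟨r, rfl⟩ := QuotientAddGroup.mk_surjective x
  change n • (r : RmodZ) = 0 at hx
  rw [← AddCircle.coe_nsmul, AddCircle.coe_eq_zero_iff] at hx
  obtain ⟨m, hm⟩ := hx
  refine ⟨Submodule.Quotient.mk ((m : ℚ) / n), ?_⟩
  rw [qmodzToRmodZ_mk]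
  change _ = (r : RmodZ)
  congr 1
  have : (n : ℝ) ≠ 0 := by exact_mod_cast hn
  push_cast
  field_simp
  simpa using hm

/-- A homomorphism from a finite abelian group to `ℝ/ℤ` factors through `ℚ/ℤ`. -/
theorem exists_lift_qmodz {N : Type} [AddCommGroup N] [Finite N] (f : N →+ RmodZ) :
    ∃ χ : N →ₗ[ℤ] QmodZ, ∀ x, qmodzToRmodZ (χ x) = f x := by
  have h : ∀ x, f.toIntLinearMap x ∈ LinearMap.range qmodzToRmodZ := fun x =>
    mem_range_qmodzToRmodZ (Nat.card_pos (α := N)).ne'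
      (by simp [← map_nsmul])
  refine ⟨(LinearEquiv.ofInjective _ qmodzToRmodZ_injective).symm.toLinearMap ∘ₗ
    f.toIntLinearMap.codRestrict _ h, fun x => ?_⟩
  exact congrArg Subtype.val ((LinearEquiv.ofInjective _ qmodzToRmodZ_injective).apply_symm_apply
    (f.toIntLinearMap.codRestrict _ h x))

theorem finite_torsion_qmodz {n : ℕ} (hn : n ≠ 0) : {x : QmodZ | n • x = 0}.Finite := by
  classical
  refine ((Finset.range n).image fun k : ℕ =>
    (Submodule.Quotient.mk ((k : ℚ) / n) : QmodZ)).finite_toSet.subset fun x hx => ?_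
  obtain ⟨q, rfl⟩ := Submodule.Quotient.mk_surjective _ x
  have hn' : (n : ℚ) ≠ 0 := by exact_mod_cast hn
  have hn0 : (n : ℤ) ≠ 0 := by exact_mod_cast hn
  rw [Set.mem_ofPred_eq, ← Submodule.Quotient.mk_smul, Submodule.Quotient.mk_eq_zero,
    Submodule.mem_span_singleton] at hx
  obtain ⟨m, hm⟩ := hx
  rw [Finset.mem_coe, Finset.mem_image]
  refine ⟨(m % n).toNat, ?_, ?_⟩
  · have := Int.emod_nonneg m hn0
    have := Int.emod_lt_of_pos m (b := n) (by omega)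
    rw [Finset.mem_range]
    omega
  · rw [Submodule.Quotient.eq, Submodule.mem_span_singleton]
    refine ⟨-(m / n), ?_⟩
    have h1 : (((m % n).toNat : ℤ) : ℚ) = m - n * (m / n : ℤ) := by
      rw [Int.toNat_of_nonneg (Int.emod_nonneg m hn0), Int.emod_def]
      push_cast
      rfl
    have h2 : (m : ℚ) = n * q := by simpa using hm
    rw [Int.cast_natCast] at h1
    rw [h1, h2]
    simp only [zsmul_eq_mul, mul_one]
    push_cast
    field_simp
    ring

instance finite_hom_qmodz {N : Type} [AddCommGroup N] [Finite N] : Finite (N →ₗ[ℤ] QmodZ) := by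
  have : Finite {x : QmodZ | Nat.card N • x = 0} :=
    (finite_torsion_qmodz (Nat.card_pos (α := N)).ne').to_subtype
  refine Finite.of_injective (β := N → {x : QmodZ | Nat.card N • x = 0})
    (fun χ x => ⟨χ x, by simp [← map_nsmul]⟩) fun χ χ' h => ?_
  ext x
  exact congrArg Subtype.val (congrFun h x)

/-! ### Characters of real vector spaces -/

/-- A real number all of whose real multiples are integers vanishes. -/
theorem eq_zero_of_forall_mul_int {a : ℝ} (h : ∀ t : ℝ, ((t * a : ℝ) : RmodZ) = 0) : a = 0 := by
  by_contra ha
  have h2 := h (2⁻¹ * a⁻¹)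
  rw [inv_mul_cancel_right₀ ha, AddCircle.coe_eq_zero_iff] at h2
  obtain ⟨n, hn⟩ := h2
  have h3 : ((2 * n : ℤ) : ℝ) = (1 : ℤ) := by
    push_cast
    rw [zsmul_eq_mul, mul_one] at hn
    rw [hn]
    norm_num
  have := Int.cast_injective h3
  omega

/-- Every continuous character of a real topological vector space (simply connected and locally
path connected) lifts to a continuous linear form. -/
theorem exists_linear_lift {V : Type} [AddCommGroup V] [Module ℝ V] [TopologicalSpace V]
    [IsTopologicalAddGroup V] [ContinuousSMul ℝ V] [SimplyConnectedSpace V]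
    [LocallyPathConnectedSpace V] (f : V →+ RmodZ) (hf : Continuous f) :
    ∃ l : V →L[ℝ] ℝ, ∀ v, ((l v : ℝ) : RmodZ) = f v := by
  obtain ⟨L, ⟨hL0, hL⟩, -⟩ := (AddCircle.isCoveringMap_coe (1 : ℝ)).existsUnique_continuousMap_lifts
    ⟨f, hf⟩ (0 : V) (0 : ℝ) (by simp)
  have hL' : ∀ v, ((L v : ℝ) : RmodZ) = f v := fun v => congrFun hL v
  have hadd : ∀ x y, L (x + y) = L x + L y := by
    let D : V × V → ℝ := fun p => L (p.1 + p.2) - L p.1 - L p.2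
    have hD : Continuous D := by fun_prop
    have hDint : ∀ p, D p ∈ Set.range ((↑) : ℤ → ℝ) := fun p => by
      have : ((D p : ℝ) : RmodZ) = 0 := by
        simp only [D, AddCircle.coe_sub, hL', map_add]
        abel
      rw [AddCircle.coe_eq_zero_iff] at this
      obtain ⟨n, hn⟩ := this
      exact ⟨n, by simpa using hn⟩
    choose N hN using hDint
    have hNc : Continuous N := by
      rw [Int.isClosedEmbedding_coe_real.isEmbedding.continuous_iff]
      exact hD.congr fun p => (hN p).symm
    intro x y
    have h1 : N (x, y) = N (0, 0) := PreconnectedSpace.constant inferInstance hNc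
    have h2 : D (x, y) = D (0, 0) := by rw [← hN, ← hN, h1]
    simp only [D, add_zero, hL0, sub_zero] at h2
    linarith
  exact ⟨(AddMonoidHom.mk' L hadd).toRealLinearMap L.continuous, hL'⟩

/-! ### The algebra `F_ℝ` and the mixed space -/

section FReal

open NumberField.mixedEmbedding NumberField.InfinitePlace Module

variable (F : Type) [Field F] [NumberField F]

theorem finrank_FReal : finrank ℝ (FReal F) = finrank ℚ F := finrank_baseChange

instance : IsTopologicalAddGroup (FReal F) :=
  topologicalAddGroup_induced (Module.finBasis ℝ (FReal F)).equivFun.toLinearMap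

instance : ContinuousSMul ℝ (FReal F) :=
  continuousSMul_induced (Module.finBasis ℝ (FReal F)).equivFun.toLinearMap

instance : T2Space (FReal F) :=
  (Topology.IsEmbedding.mk ⟨rfl⟩ (Module.finBasis ℝ (FReal F)).equivFun.injective).t2Space

/-- The natural map from `F_ℝ` to the mixed space. -/
noncomputable def toMixedHom : FReal F →ₐ[ℝ] mixedSpace F :=
  Algebra.TensorProduct.lift (Algebra.ofId ℝ (mixedSpace F))
    { NumberField.mixedEmbedding F with
      commutes' := fun q => RingHom.congr_fun (Subsingleton.elim
        ((NumberField.mixedEmbedding F).comp (algebraMap ℚ F)) (algebraMap ℚ (mixedSpace F))) q }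
    fun _ _ => .all _ _

theorem toMixedHom_tmul (r : ℝ) (x : F) :
    toMixedHom F (r ⊗ₜ x) = r • NumberField.mixedEmbedding F x := by
  rw [toMixedHom, Algebra.TensorProduct.lift_tmul, Algebra.ofId_apply, ← Algebra.smul_def]
  rfl

theorem toMixedHom_bijective : Function.Bijective (toMixedHom F) := by
  have hs : Function.Surjective (toMixedHom F).toLinearMap := by
    rw [← LinearMap.range_eq_top, eq_top_iff, ← (latticeBasis F).span_eq, Submodule.span_le]
    rintro _ ⟨i, rfl⟩
    refine ⟨1 ⊗ₜ integralBasis F i, ?_⟩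
    simp [toMixedHom_tmul]
  refine ⟨?_, hs⟩
  refine (LinearMap.injective_iff_surjective_of_finrank_eq_finrank
    (f := (toMixedHom F).toLinearMap) ?_).2 hs
  rw [finrank_FReal, mixedEmbedding.finrank]

/-- The algebra `F_ℝ` is isomorphic to the mixed space. -/
noncomputable def toMixed : FReal F ≃ₐ[ℝ] mixedSpace F :=
  AlgEquiv.ofBijective (toMixedHom F) (toMixedHom_bijective F)

theorem toMixed_tmul (r : ℝ) (x : F) :
    toMixed F (r ⊗ₜ x) = r • NumberField.mixedEmbedding F x :=
  toMixedHom_tmul F r x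

theorem continuous_toMixed : Continuous (toMixed F) :=
  (toMixed F).toLinearMap.continuous_of_finiteDimensional

theorem continuous_toMixed_symm : Continuous (toMixed F).symm :=
  (toMixed F).symm.toLinearMap.continuous_of_finiteDimensional

theorem abs_norm_mixedSpace (x : mixedSpace F) :
    |Algebra.norm ℝ x| = mixedEmbedding.norm x := by
  classical
  have h1 : Algebra.lmul ℝ (mixedSpace F) x = LinearMap.prodMap
      (LinearMap.pi fun w => (Algebra.lmul ℝ ℝ (x.1 w)).comp (LinearMap.proj w))
      (LinearMap.pi fun w => (Algebra.lmul ℝ ℂ (x.2 w)).comp (LinearMap.proj w)) := rfl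
  rw [Algebra.norm_apply, h1, LinearMap.det_prodMap, LinearMap.det_pi, LinearMap.det_pi]
  simp_rw [← Algebra.norm_apply, Algebra.norm_complex_apply, Algebra.norm_self,
    MonoidHom.id_apply]
  rw [mixedEmbedding.norm_apply, prod_eq_prod_mul_prod, abs_mul, Finset.abs_prod, Finset.abs_prod]
  congr 1
  · refine Finset.prod_congr rfl fun w _ => ?_
    rw [mult_isReal, pow_one, normAtPlace_apply_of_isReal w.2, Real.norm_eq_abs]
  · refine Finset.prod_congr rfl fun w _ => ?_
    rw [mult_isComplex, normAtPlace_apply_of_isComplex w.2, Complex.normSq_eq_norm_sq,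
      abs_of_nonneg (by positivity)]

theorem abs_norm_FReal (b : FReal F) : |Algebra.norm ℝ b| = mixedEmbedding.norm (toMixed F b) := by
  rw [← abs_norm_mixedSpace, Algebra.norm_eq_of_algEquiv]

/-- The `ℝ`-algebra homomorphism `F_ℝ → ℂ` attached to a complex embedding. -/
noncomputable def evalEmb {F : Type} [Field F] [NumberField F] (φ : F →+* ℂ) : FReal F →ₐ[ℝ] ℂ :=
  Algebra.TensorProduct.lift (Algebra.ofId ℝ ℂ)
    { φ with commutes' := fun q => by simp } fun _ _ => .all _ _

variable {F}

theorem evalEmb_tmul (φ : F →+* ℂ) (r : ℝ) (x : F) : evalEmb φ (r ⊗ₜ x) = r * φ x := by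
  rw [evalEmb, Algebra.TensorProduct.lift_tmul, Algebra.ofId_apply]
  rfl

theorem evalEmb_conj (φ : F →+* ℂ) (b : FReal F) :
    evalEmb (ComplexEmbedding.conjugate φ) b = starRingEnd ℂ (evalEmb φ b) := by
  induction b using TensorProduct.induction_on with
  | zero => simp
  | tmul r x => simp [evalEmb_tmul, ComplexEmbedding.conjugate_coe_eq]
  | add a b ha hb => simp only [map_add, ha, hb]

theorem normAtPlace_toMixed (w : InfinitePlace F) (b : FReal F) :
    normAtPlace w (toMixed F b) = ‖evalEmb w.embedding b‖ := by
  rcases w.isReal_or_isComplex with hw | hw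
  · rw [normAtPlace_apply_of_isReal hw]
    have h : evalEmb w.embedding b = (((toMixed F b).1 ⟨w, hw⟩ : ℝ) : ℂ) := by
      induction b using TensorProduct.induction_on with
      | zero => simp
      | tmul r x => simp [evalEmb_tmul, toMixed_tmul, mixedEmbedding_apply_isReal]
      | add a b ha hb => simp only [map_add, ha, hb, Prod.fst_add, Pi.add_apply, Complex.ofReal_add]
    rw [h, Complex.norm_real]
  · rw [normAtPlace_apply_of_isComplex hw]
    congr 1
    induction b using TensorProduct.induction_on with
    | zero => simp
    | tmul r x => simp [evalEmb_tmul, toMixed_tmul, mixedEmbedding_apply_isComplex]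
    | add a b ha hb => simp only [map_add, ← ha, ← hb, Prod.snd_add, Pi.add_apply]

theorem evalEmb_galFReal {K : Type} [Field K] [CharZero K] [Algebra K F] (g : F ≃ₐ[K] F)
    (φ : F →+* ℂ) (b : FReal F) :
    evalEmb φ (galFReal K g b) = evalEmb (φ.comp (g : F →+* F)) b := by
  induction b using TensorProduct.induction_on with
  | zero => simp
  | tmul r x => simp [evalEmb_tmul, galFReal]
  | add a b ha hb => simp only [map_add, ha, hb]

theorem normAtPlace_galFReal {K : Type} [Field K] [CharZero K] [Algebra K F] (g : F ≃ₐ[K] F)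
    (w : InfinitePlace F) (b : FReal F) :
    normAtPlace w (toMixed F (galFReal K g b)) =
      normAtPlace (w.comap (g : F →+* F)) (toMixed F b) := by
  rw [normAtPlace_toMixed, normAtPlace_toMixed, evalEmb_galFReal]
  have h : InfinitePlace.mk (w.embedding.comp (g : F →+* F)) =
      InfinitePlace.mk (w.comap (g : F →+* F)).embedding := by
    rw [mk_embedding, ← comap_mk, mk_embedding]
  rcases mk_eq_iff.1 h with h | h
  · rw [h]
  · rw [← h, evalEmb_conj, Complex.norm_conj]

end FReal

/-! ### Logarithms at the infinite places -/

section PlaceLog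

open NumberField.mixedEmbedding NumberField.InfinitePlace NumberField.Units
  NumberField.Units.dirichletUnitTheorem

theorem mixedSpaceOfRealSpace_mul {F : Type} [Field F] (x y : realSpace F) :
    mixedSpaceOfRealSpace (x * y) = mixedSpaceOfRealSpace x * mixedSpaceOfRealSpace y := by
  ext w <;> simp [mixedSpaceOfRealSpace_apply]

theorem mixedSpaceOfRealSpace_one {F : Type} [Field F] :
    mixedSpaceOfRealSpace (1 : realSpace F) = 1 := by
  ext w <;> simp [mixedSpaceOfRealSpace_apply]

theorem mixedSpace_mul_star {F : Type} [Field F] {x : mixedSpace F}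
    (hx : ∀ w, normAtPlace w x = 1) : x * star x = 1 := by
  ext w
  · have h := hx w
    rw [normAtPlace_apply_of_isReal w.2, Real.norm_eq_abs] at h
    have h2 : x.1 w * x.1 w = 1 := by rw [← abs_mul_abs_self, h, one_mul]
    simpa using h2
  · have h := hx w
    rw [normAtPlace_apply_of_isComplex w.2] at h
    have h2 : x.2 w * star (x.2 w) = 1 := by
      rw [Complex.star_def, Complex.mul_conj, Complex.normSq_eq_norm_sq, h]
      simp
    simpa using h2

variable (F : Type) [Field F] [NumberField F]

theorem normAtPlace_unit_pos (w : InfinitePlace F) (b : (FReal F)ˣ) :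
    0 < normAtPlace w (toMixed F b) := by
  refine (normAtPlace_nonneg w _).lt_of_ne' ?_
  exact ((b.isUnit.map (toMixed F)).map (normAtPlace w)).ne_zero

/-- The logarithms of the normalized absolute values of a unit of `F_ℝ`. -/
noncomputable def placeLog : Additive (FReal F)ˣ →+ realSpace F where
  toFun b w := mult w * Real.log (normAtPlace w (toMixed F (b.toMul : FReal F)))
  map_zero' := by
    ext w
    simp
  map_add' a b := by
    ext w
    simp only [toMul_add, Units.val_mul, map_mul, Pi.add_apply]
    rw [Real.log_mul (normAtPlace_unit_pos F w _).ne' (normAtPlace_unit_pos F w _).ne', mul_add]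

variable {F}

theorem placeLog_apply (b : (FReal F)ˣ) (w : InfinitePlace F) :
    placeLog F (.ofMul b) w = mult w * Real.log (normAtPlace w (toMixed F (b : FReal F))) := rfl

theorem continuous_placeLog : Continuous fun b : (FReal F)ˣ => placeLog F (.ofMul b) := by
  refine continuous_pi fun w => ?_
  simp only [placeLog_apply]
  refine continuous_const.mul (Continuous.log ?_ fun b => (normAtPlace_unit_pos F w b).ne')
  exact (continuous_normAtPlace w).comp ((continuous_toMixed F).comp Units.continuous_val)

theorem placeLog_eq_zero_iff (b : (FReal F)ˣ) :
    placeLog F (.ofMul b) = 0 ↔ ∀ w, normAtPlace w (toMixed F (b : FReal F)) = 1 := by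
  rw [funext_iff]
  refine forall_congr' fun w => ?_
  rw [placeLog_apply, Pi.zero_apply, mul_eq_zero, or_iff_right (by simp [mult_ne_zero])]
  refine ⟨fun h => Real.eq_one_of_pos_of_log_eq_zero (normAtPlace_unit_pos F w b) h, fun h => ?_⟩
  rw [h, Real.log_one]

theorem mem_ker_absNormFR_iff (b : (FReal F)ˣ) :
    b ∈ (absNormFR F).ker ↔ mixedEmbedding.norm (toMixed F (b : FReal F)) = 1 := by
  rw [MonoidHom.mem_ker, Units.ext_iff, ← abs_norm_FReal]
  rfl

theorem mem_ker_absNormFR_iff_sum (b : (FReal F)ˣ) :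
    b ∈ (absNormFR F).ker ↔ ∑ w, placeLog F (.ofMul b) w = 0 := by
  have h : ∀ w ∈ Finset.univ, normAtPlace w (toMixed F (b : FReal F)) ^ mult w ≠ 0 :=
    fun w _ => pow_ne_zero _ (normAtPlace_unit_pos F w b).ne'
  have h2 : ∑ w, placeLog F (.ofMul b) w =
      Real.log (mixedEmbedding.norm (toMixed F (b : FReal F))) := by
    rw [mixedEmbedding.norm_apply, Real.log_prod h]
    exact Finset.sum_congr rfl fun w _ => by rw [placeLog_apply, Real.log_pow]
  rw [mem_ker_absNormFR_iff, h2]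
  refine ⟨fun h => by rw [h, Real.log_one], fun h3 => Real.eq_one_of_pos_of_log_eq_zero ?_ h3⟩
  rw [mixedEmbedding.norm_apply]
  exact Finset.prod_pos fun w _ => pow_pos (normAtPlace_unit_pos F w b) _

/-- The element of `F_ℝ` with prescribed logarithms at the infinite places. -/
noncomputable def expFReal (t : realSpace F) : FReal F :=
  (toMixed F).symm (mixedSpaceOfRealSpace fun w => Real.exp (t w / mult w))

theorem expFReal_add (s t : realSpace F) : expFReal (s + t) = expFReal s * expFReal t := by
  rw [expFReal, expFReal, expFReal, ← map_mul, ← mixedSpaceOfRealSpace_mul]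
  congr 2
  ext w
  simp [add_div, Real.exp_add]

theorem expFReal_zero : expFReal (0 : realSpace F) = 1 := by
  rw [expFReal, ← map_one (toMixed F).symm, ← mixedSpaceOfRealSpace_one]
  congr 2
  ext w
  simp

theorem continuous_expFReal : Continuous (expFReal (F := F)) := by
  refine (continuous_toMixed_symm F).comp (mixedSpaceOfRealSpace.continuous.comp ?_)
  fun_prop

variable (F) in
/-- The exponential map from the logarithmic space of all infinite places to `F_ℝˣ`. -/
noncomputable def expUnit : realSpace F →+ Additive (FReal F)ˣ where
  toFun t := .ofMul
    { val := expFReal t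
      inv := expFReal (-t)
      val_inv := by rw [← expFReal_add, add_neg_cancel, expFReal_zero]
      inv_val := by rw [← expFReal_add, neg_add_cancel, expFReal_zero] }
  map_zero' := congrArg Additive.ofMul (Units.ext expFReal_zero)
  map_add' s t := congrArg Additive.ofMul (Units.ext (expFReal_add s t))

theorem continuous_expUnit : Continuous fun t : realSpace F => (expUnit F t).toMul :=
  Units.continuous_iff.2 ⟨continuous_expFReal, continuous_expFReal.comp continuous_neg⟩

theorem placeLog_expUnit (t : realSpace F) : placeLog F (expUnit F t) = t := by
  ext w
  have h : toMixed F ((expUnit F t).toMul : FReal F) =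
    mixedSpaceOfRealSpace fun w => Real.exp (t w / mult w) := (toMixed F).apply_symm_apply _
  change mult w * Real.log (normAtPlace w (toMixed F ((expUnit F t).toMul : FReal F))) = _
  rw [h, normAtPlace_mixedSpaceOfRealSpace (Real.exp_nonneg _), Real.log_exp, mul_div_cancel₀]
  simp [mult_ne_zero]

/-- A compact subgroup of `F_ℝˣ` lies in the kernel of the logarithm. -/
theorem placeLog_eq_zero_of_isCompact {H : Subgroup (FReal F)ˣ}
    (hH : IsCompact (H : Set (FReal F)ˣ)) {b : (FReal F)ˣ} (hb : b ∈ H) :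
    placeLog F (.ofMul b) = 0 := by
  obtain ⟨C, hC⟩ := (hH.image continuous_placeLog).isBounded.exists_norm_le
  by_contra h0
  have hpos : 0 < ‖placeLog F (.ofMul b)‖ := norm_pos_iff.2 h0
  obtain ⟨n, hn⟩ := exists_nat_gt (C / ‖placeLog F (.ofMul b)‖)
  have h1 := hC _ ⟨b ^ n, H.pow_mem hb n, rfl⟩
  simp only [ofMul_pow, map_nsmul] at h1
  rw [← Nat.cast_smul_eq_nsmul ℝ, _root_.norm_smul, Real.norm_natCast] at h1
  rw [div_lt_iff₀ hpos] at hn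
  linarith

theorem isCompact_ker_placeLog : IsCompact {b : (FReal F)ˣ | placeLog F (.ofMul b) = 0} := by
  classical
  let S : Set (mixedSpace F) := {x | ∀ w, normAtPlace w x = 1}
  have hS : IsCompact S := by
    refine Metric.isCompact_of_isClosed_isBounded (α := mixedSpace F) ?_ ?_
    · simp only [S, Set.ofPred_forall]
      exact isClosed_iInter fun w => isClosed_eq (continuous_normAtPlace w) continuous_const
    · refine isBounded_iff_forall_norm_le.2 ⟨1, fun x hx => ?_⟩
      rw [norm_eq_sup'_normAtPlace]
      exact Finset.sup'_le _ _ fun w _ => (hx w).le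
  have : CompactSpace S := isCompact_iff_compactSpace.1 hS
  let u : S → (FReal F)ˣ := fun x =>
    { val := (toMixed F).symm x
      inv := (toMixed F).symm (star (x : mixedSpace F))
      val_inv := by rw [← map_mul, mixedSpace_mul_star x.2, map_one]
      inv_val := by rw [← map_mul, mul_comm, mixedSpace_mul_star x.2, map_one] }
  have hu : Continuous u := Units.continuous_iff.2
    ⟨(continuous_toMixed_symm F).comp continuous_subtype_val,
      (continuous_toMixed_symm F).comp (continuous_star.comp continuous_subtype_val)⟩
  convert isCompact_range hu
  ext b
  rw [Set.mem_ofPred_eq, placeLog_eq_zero_iff]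
  constructor
  · intro h
    exact ⟨⟨toMixed F b, h⟩, Units.ext ((toMixed F).symm_apply_apply _)⟩
  · rintro ⟨x, rfl⟩ w
    have : toMixed F (u x : FReal F) = x := (toMixed F).apply_symm_apply _
    rw [this]
    exact x.2 w

theorem mem_maxCompact_iff (b : (FReal F)ˣ) :
    b ∈ maxCompact F ↔ placeLog F (.ofMul b) = 0 := by
  let Z : Subgroup (FReal F)ˣ := AddSubgroup.toSubgroup' (placeLog F).ker
  have hZ : ∀ b, b ∈ Z ↔ placeLog F (.ofMul b) = 0 := fun b => Iff.rfl
  constructor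
  · intro h
    have hle : maxCompact F ≤ Z := sSup_le fun H hH b hb =>
      (hZ b).2 (placeLog_eq_zero_of_isCompact hH hb)
    exact hle h
  · intro h
    have hc : IsCompact (Z : Set (FReal F)ˣ) := isCompact_ker_placeLog
    exact le_sSup (a := Z) hc ((hZ b).2 h)

/-! ### Units and the logarithmic space -/

variable (F) in
/-- A unit of `𝓞 F` as a unit of `F_ℝ`. -/
noncomputable def unitToFReal : Fˣ →* (FReal F)ˣ :=
  Units.map (Algebra.TensorProduct.includeRight : F →ₐ[ℚ] FReal F).toMonoidHom

theorem toMixed_unitToFReal (α : Fˣ) :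
    toMixed F (unitToFReal F α : FReal F) = NumberField.mixedEmbedding F α := by
  have := toMixed_tmul F 1 (α : F)
  rwa [one_smul] at this

theorem placeLog_unitToFReal (α : Fˣ) (w : InfinitePlace F) :
    placeLog F (.ofMul (unitToFReal F α)) w = mult w * Real.log (w α) := by
  rw [placeLog_apply, toMixed_unitToFReal, normAtPlace_apply]

variable (F) in
/-- The extension of a vector in the logarithmic space to a vector with vanishing sum. -/
noncomputable def extendLog : logSpace F →ₗ[ℝ] realSpace F := by
  classical
  exact
  { toFun := fun v w => if h : w = w₀ then -∑ i, v i else v ⟨w, h⟩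
    map_add' := fun v v' => by
      ext w
      by_cases h : w = w₀
      · simp [h, Finset.sum_add_distrib, add_comm]
      · simp [h]
    map_smul' := fun c v => by
      ext w
      by_cases h : w = w₀
      · simp [h, Finset.mul_sum]
      · simp [h] }

theorem extendLog_apply_ne (v : logSpace F) (i : {w : InfinitePlace F // w ≠ w₀}) :
    extendLog F v i = v i := by
  simp [extendLog, i.2]

open scoped Classical in
theorem sum_realSpace (x : realSpace F) :
    ∑ w, x w = x w₀ + ∑ i : {w : InfinitePlace F // w ≠ w₀}, x i := by
  classical
  rw [Fintype.sum_eq_add_sum_subtype_ne x w₀]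

theorem sum_extendLog (v : logSpace F) : ∑ w, extendLog F v w = 0 := by
  classical
  rw [sum_realSpace]
  simp_rw [extendLog_apply_ne]
  simp [extendLog]

theorem eq_of_sum_eq_zero {x y : realSpace F} (hx : ∑ w, x w = 0) (hy : ∑ w, y w = 0)
    (h : ∀ i : {w : InfinitePlace F // w ≠ w₀}, x i = y i) : x = y := by
  classical
  rw [sum_realSpace] at hx hy
  ext w
  by_cases hw : w = w₀
  · simp_rw [h] at hx
    rw [hw]
    linarith
  · exact h ⟨w, hw⟩

variable (F) in
/-- The logarithm of a unit of `F_ℝ` in the logarithmic space. -/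
noncomputable def resLog : Additive (FReal F)ˣ →+ logSpace F :=
  (LinearMap.funLeft ℝ ℝ Subtype.val).toAddMonoidHom.comp (placeLog F)

theorem resLog_apply (b : Additive (FReal F)ˣ) (i : {w : InfinitePlace F // w ≠ w₀}) :
    resLog F b i = placeLog F b i := rfl

theorem continuous_resLog : Continuous fun b : (FReal F)ˣ => resLog F (.ofMul b) :=
  continuous_pi fun i => (continuous_apply i.1).comp continuous_placeLog

theorem extendLog_resLog {b : (FReal F)ˣ} (hb : b ∈ (absNormFR F).ker) :
    extendLog F (resLog F (.ofMul b)) = placeLog F (.ofMul b) :=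
  eq_of_sum_eq_zero (sum_extendLog _) ((mem_ker_absNormFR_iff_sum b).1 hb) fun i =>
    (extendLog_apply_ne _ i).trans (resLog_apply _ i)

theorem resLog_unit (u : (𝓞 F)ˣ) :
    resLog F (.ofMul (unitToFReal F (Units.map (algebraMap (𝓞 F) F).toMonoidHom u))) =
      logEmbedding F (.ofMul u) := by
  ext i
  rw [resLog_apply, placeLog_unitToFReal, logEmbedding_component]
  rfl

theorem unitToFReal_mem_ker (u : (𝓞 F)ˣ) :
    unitToFReal F (Units.map (algebraMap (𝓞 F) F).toMonoidHom u) ∈ (absNormFR F).ker := by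
  rw [mem_ker_absNormFR_iff, toMixed_unitToFReal]
  exact norm_unit u

variable (F) in
/-- The logarithmic embedding of the units modulo torsion. -/
noncomputable def unitsModTorsionLog :
    Additive ((𝓞 F)ˣ ⧸ CommGroup.torsion (𝓞 F)ˣ) →+ logSpace F :=
  MonoidHom.toAdditiveLeft <| QuotientGroup.lift (CommGroup.torsion (𝓞 F)ˣ)
    (AddMonoidHom.toMultiplicativeRight (logEmbedding F)) fun _ hu =>
      congrArg Multiplicative.ofAdd (logEmbedding_eq_zero_iff.2 hu)

theorem unitsModTorsionLog_injective : Function.Injective (unitsModTorsionLog F) := by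
  rw [injective_iff_map_eq_zero]
  intro x hx
  obtain ⟨u, hu⟩ := QuotientGroup.mk_surjective x.toMul
  obtain rfl : Additive.ofMul (QuotientGroup.mk u) = x := congrArg Additive.ofMul hu
  have h : u ∈ CommGroup.torsion (𝓞 F)ˣ := logEmbedding_eq_zero_iff.1 hx
  exact congrArg Additive.ofMul ((QuotientGroup.eq_one_iff u).2 h)

variable (F) in
/-- The units modulo torsion are isomorphic to the unit lattice. -/
noncomputable def unitsModTorsionEquiv :
    Additive ((𝓞 F)ˣ ⧸ CommGroup.torsion (𝓞 F)ˣ) ≃ₗ[ℤ] unitLattice F :=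
  LinearEquiv.ofBijective
    ((unitsModTorsionLog F).toIntLinearMap.codRestrict (unitLattice F) fun x => by
      obtain ⟨u, hu⟩ := QuotientGroup.mk_surjective x.toMul
      obtain rfl : Additive.ofMul (QuotientGroup.mk u) = x := congrArg Additive.ofMul hu
      exact Submodule.mem_map_of_mem trivial)
    ⟨fun x y h => unitsModTorsionLog_injective (congrArg Subtype.val h), by
      rintro ⟨_, u, -, rfl⟩
      exact ⟨.ofMul (QuotientGroup.mk u.toMul), rfl⟩⟩

instance : Module.Free ℤ (Additive ((𝓞 F)ˣ ⧸ CommGroup.torsion (𝓞 F)ˣ)) := by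
  classical
  have := ZLattice.module_free ℝ (unitLattice F)
  exact .of_equiv (unitsModTorsionEquiv F).symm

instance : Module.Finite ℤ (Additive ((𝓞 F)ˣ ⧸ CommGroup.torsion (𝓞 F)ˣ)) := by
  classical
  have := ZLattice.module_finite ℝ (unitLattice F)
  exact .equiv (unitsModTorsionEquiv F).symm

theorem exists_linear_extension (f : Additive ((𝓞 F)ˣ ⧸ CommGroup.torsion (𝓞 F)ˣ) →ₗ[ℤ] ℤ) :
    ∃ l : logSpace F →ₗ[ℝ] ℝ, ∀ u : (𝓞 F)ˣ,
      l (logEmbedding F (.ofMul u)) = f (.ofMul (QuotientGroup.mk u)) := by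
  classical
  let b := (basisUnitLattice F).ofZLatticeBasis ℝ (unitLattice F)
  let f' : unitLattice F →ₗ[ℤ] ℤ := f ∘ₗ (unitsModTorsionEquiv F).symm.toLinearMap
  let l : logSpace F →ₗ[ℝ] ℝ := b.constr ℝ fun i => ((f' (basisUnitLattice F i) : ℤ) : ℝ)
  have hl : l.toAddMonoidHom.toIntLinearMap ∘ₗ (unitLattice F).subtype =
      (Int.castAddHom ℝ).toIntLinearMap ∘ₗ f' := by
    refine (basisUnitLattice F).ext fun i => ?_
    change l (basisUnitLattice F i : logSpace F) = ((f' (basisUnitLattice F i) : ℤ) : ℝ)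
    have hb : b i = (basisUnitLattice F i : logSpace F) :=
      (basisUnitLattice F).ofZLatticeBasis_apply ℝ (unitLattice F) i
    rw [← hb]
    exact b.constr_basis ℝ _ i
  refine ⟨l, fun u => ?_⟩
  have := LinearMap.congr_fun hl (unitsModTorsionEquiv F (.ofMul (QuotientGroup.mk u)))
  have h2 : f' (unitsModTorsionEquiv F (.ofMul (QuotientGroup.mk u))) =
      f (.ofMul (QuotientGroup.mk u)) := by
    change f ((unitsModTorsionEquiv F).symm _) = _
    rw [LinearEquiv.symm_apply_apply]
  rw [← h2]
  exact this

end PlaceLog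


section ArakelovClassGroup

open NumberField.InfinitePlace NumberField.mixedEmbedding NumberField.Units
  NumberField.Units.dirichletUnitTheorem

variable (F : Type) [Field F] [NumberField F]

/-- The projection to the Arakelov class group as a homomorphism. -/
noncomputable def picMk : picDom F →* PicZero F :=
  (QuotientGroup.mk' (compImage F)).comp (QuotientGroup.mk' (principalSub F))

theorem isQuotientMap_picMk : Topology.IsQuotientMap (picMk F) :=
  (QuotientGroup.isQuotientMap_mk (compImage F)).comp
    (QuotientGroup.isQuotientMap_mk (principalSub F))

theorem picMk_surjective : Function.Surjective (picMk F) := (isQuotientMap_picMk F).surjective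

variable {F}

theorem mem_picDom_iff (x : IdealGroup F × (FReal F)ˣ) :
    x ∈ picDom F ↔ idealNormHom F x.1 = absNormFR F x.2 := by
  rw [picDom, MonoidHom.mem_ker, MonoidHom.div_apply, div_eq_one]
  rfl

theorem mem_ker_absNormFR_of_mem_maxCompact {c : (FReal F)ˣ} (hc : c ∈ maxCompact F) :
    c ∈ (absNormFR F).ker := by
  rw [mem_maxCompact_iff] at hc
  rw [mem_ker_absNormFR_iff_sum, hc]
  exact Finset.sum_const_zero

theorem principalHom_mem_picDom (α : Fˣ) :
    (toPrincipalIdeal (𝓞 F) F α, unitToFReal F α) ∈ picDom F := by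
  rw [mem_picDom_iff, Units.ext_iff]
  have h1 : (absNormFR F (unitToFReal F α) : ℝ) = |Algebra.norm ℝ (unitToFReal F α : FReal F)| :=
    rfl
  have h2 : (idealNormHom F (toPrincipalIdeal (𝓞 F) F α) : ℝ) =
      (FractionalIdeal.absNorm (toPrincipalIdeal (𝓞 F) F α : FractionalIdeal (𝓞 F)⁰ F) : ℝ) := rfl
  rw [h1, h2, abs_norm_FReal, toMixed_unitToFReal, mixedEmbedding.norm_eq_norm,
    coe_toPrincipalIdeal, FractionalIdeal.absNorm_span_singleton]

variable (F) in
/-- The embedding of the elements of norm one of `F_ℝˣ` into the fibre product. -/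
noncomputable def archDom : (absNormFR F).ker →* picDom F :=
  ((MonoidHom.inr (IdealGroup F) (FReal F)ˣ).comp (absNormFR F).ker.subtype).codRestrict (picDom F)
    fun b => (mem_picDom_iff _).2 <| (map_one _).trans (MonoidHom.mem_ker.1 b.2).symm

theorem archDom_fst (b : (absNormFR F).ker) : (archDom F b).1.1 = 1 := rfl

theorem exists_archDom_eq {x : picDom F} (hx : x.1.1 = 1) : ∃ b, archDom F b = x := by
  have h := (mem_picDom_iff x.1).1 x.2
  rw [hx, map_one] at h
  exact ⟨⟨x.1.2, h.symm⟩, Subtype.ext (Prod.ext hx.symm rfl)⟩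

theorem picMk_eq_one_iff (x : picDom F) :
    picMk F x = 1 ↔ ∃ α : Fˣ, ∃ c ∈ maxCompact F,
      x.1 = (toPrincipalIdeal (𝓞 F) F α, unitToFReal F α * c) := by
  have h0 : picMk F x = 1 ↔ QuotientGroup.mk' (principalSub F) x ∈ compImage F :=
    QuotientGroup.eq_one_iff (N := compImage F) _
  refine h0.trans ⟨?_, ?_⟩
  · rintro ⟨z, hz, hzx⟩
    obtain ⟨α, hα⟩ := (QuotientGroup.eq (s := principalSub F)).1 hzx
    obtain ⟨hz1, hz2⟩ := Subgroup.mem_prod.1 (Subgroup.mem_comap.1 hz)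
    refine ⟨α, z.1.2, hz2, ?_⟩
    have hz1' : z.1.1 = 1 := hz1
    have h1 : x.1 = z.1 * principalHom F α := by
      rw [hα]
      exact (mul_inv_cancel_left _ _).symm
    rw [h1]
    refine Prod.ext ?_ (mul_comm _ _)
    change z.1.1 * _ = _
    rw [hz1', one_mul]
    rfl
  · rintro ⟨α, c, hc, hx⟩
    refine ⟨archDom F ⟨c, mem_ker_absNormFR_of_mem_maxCompact hc⟩, ⟨rfl, hc⟩, ?_⟩
    refine (QuotientGroup.eq (s := principalSub F)).2 ⟨α, ?_⟩
    change _ = (archDom F ⟨c, _⟩).1⁻¹ * x.1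
    rw [hx, eq_inv_mul_iff_mul_eq]
    exact Prod.ext (one_mul _) (mul_comm _ _)

variable (F) in
/-- The archimedean part of the Arakelov class group. -/
noncomputable def archClass : (absNormFR F).ker →* PicZero F := (picMk F).comp (archDom F)

theorem archClass_unit (u : (𝓞 F)ˣ) : archClass F ⟨_, unitToFReal_mem_ker u⟩ = 1 := by
  refine (picMk_eq_one_iff _).2 ⟨Units.map (algebraMap (𝓞 F) F).toMonoidHom u, 1, one_mem _, ?_⟩
  refine Prod.ext ?_ (mul_one _).symm
  refine ((toPrincipalIdeal_eq_iff (I := 1)).2 ?_).symm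
  refine le_antisymm ?_ ?_
  · rw [FractionalIdeal.spanSingleton_le_iff_mem]
    exact (FractionalIdeal.mem_one_iff _).2 ⟨u, rfl⟩
  · rintro x hx
    obtain ⟨r, rfl⟩ := (FractionalIdeal.mem_one_iff _).1 hx
    refine (FractionalIdeal.mem_spanSingleton _).2 ⟨r * (u⁻¹ : (𝓞 F)ˣ), ?_⟩
    change (r * (u⁻¹ : (𝓞 F)ˣ) : 𝓞 F) • algebraMap (𝓞 F) F u = algebraMap (𝓞 F) F r
    rw [Algebra.smul_def, ← map_mul, mul_assoc, Units.inv_mul, mul_one]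

theorem archClass_eq_one_of_resLog {b : (absNormFR F).ker} (hb : resLog F (.ofMul b.1) = 0) :
    archClass F b = 1 := by
  refine (picMk_eq_one_iff _).2 ⟨1, b, ?_, ?_⟩
  · rw [mem_maxCompact_iff, ← extendLog_resLog b.2, hb, map_zero]
  · rw [map_one, map_one, one_mul]
    rfl

theorem archClass_eq_of_resLog {b c : (absNormFR F).ker}
    (h : resLog F (.ofMul b.1) = resLog F (.ofMul c.1)) : archClass F b = archClass F c := by
  rw [← div_eq_one, ← map_div]
  apply archClass_eq_one_of_resLog
  change resLog F (.ofMul (b.1 / c.1)) = 0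
  rw [ofMul_div, map_sub, h, sub_self]

theorem exists_unit_of_archClass_eq_one {b : (absNormFR F).ker} (h : archClass F b = 1) :
    ∃ u : (𝓞 F)ˣ, resLog F (.ofMul b.1) = logEmbedding F (.ofMul u) := by
  obtain ⟨α, c, hc, hx⟩ := (picMk_eq_one_iff _).1 h
  have h1 : toPrincipalIdeal (𝓞 F) F α = 1 := (congrArg Prod.fst hx).symm
  have h2 : b.1 = unitToFReal F α * c := congrArg Prod.snd hx
  have int_of_eq : ∀ β : Fˣ, toPrincipalIdeal (𝓞 F) F β = 1 →
      ∃ r : 𝓞 F, algebraMap (𝓞 F) F r = β := fun β hβ => by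
    rw [toPrincipalIdeal_eq_iff] at hβ
    refine (FractionalIdeal.mem_one_iff (𝓞 F)⁰).1 ?_
    rw [Units.val_one] at hβ
    rw [← hβ]
    exact FractionalIdeal.mem_spanSingleton_self _ _
  obtain ⟨r, hr⟩ := int_of_eq α h1
  obtain ⟨s, hs⟩ := int_of_eq α⁻¹ (by rw [map_inv, h1, inv_one])
  have hrs : r * s = 1 := by
    apply RingOfIntegers.coe_injective
    rw [map_mul, map_one, hr, hs, Units.mul_inv]
  let u : (𝓞 F)ˣ := ⟨r, s, hrs, by rw [mul_comm, hrs]⟩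
  have hu : Units.map (algebraMap (𝓞 F) F).toMonoidHom u = α := Units.ext hr
  refine ⟨u, ?_⟩
  have hc0 : resLog F (.ofMul c) = 0 := by
    ext i
    rw [resLog_apply, (mem_maxCompact_iff c).1 hc]
    rfl
  rw [← resLog_unit, hu, h2, ofMul_mul, map_add, hc0, add_zero]

variable (F) in
/-- The exponential of a vector in the logarithmic space as an element of norm one of `F_ℝˣ`. -/
noncomputable def expKer : logSpace F →+ Additive (absNormFR F).ker where
  toFun v := .ofMul ⟨(expUnit F (extendLog F v)).toMul, by
    rw [mem_ker_absNormFR_iff_sum]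
    simp only [ofMul_toMul, placeLog_expUnit]
    exact sum_extendLog v⟩
  map_zero' := congrArg Additive.ofMul (Subtype.ext (by simp))
  map_add' v w := congrArg Additive.ofMul (Subtype.ext (by simp))

theorem placeLog_expKer (v : logSpace F) :
    placeLog F (.ofMul ((expKer F v).toMul : (FReal F)ˣ)) = extendLog F v :=
  placeLog_expUnit _

theorem resLog_expKer (v : logSpace F) :
    resLog F (.ofMul ((expKer F v).toMul : (FReal F)ˣ)) = v := by
  ext i
  rw [resLog_apply, placeLog_expKer, extendLog_apply_ne]

theorem continuous_extendLog : Continuous (extendLog F) := by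
  classical
  exact LinearMap.continuous_of_finiteDimensional _

theorem continuous_archClass_expKer :
    Continuous fun v : logSpace F => archClass F (expKer F v).toMul := by
  refine (isQuotientMap_picMk F).continuous.comp ?_
  refine Continuous.subtype_mk (f := fun v => ((1 : IdealGroup F), _)) ?_ _
  exact continuous_const.prodMk (continuous_expUnit.comp continuous_extendLog)

/-- A function on the fibre product that only depends on the ideal is continuous. -/
theorem continuous_of_ideal {X : Type} [TopologicalSpace X] [Nonempty X] {h : picDom F → X}
    (hh : ∀ x y : picDom F, x.1.1 = y.1.1 → h x = h y) : Continuous h := by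
  obtain ⟨e, rfl⟩ := (Function.factorsThrough_iff (f := fun x : picDom F => x.1.1) h).1
    fun x y hxy => hh x y hxy
  have : DiscreteTopology (IdealGroup F) := ⟨rfl⟩
  exact continuous_of_discreteTopology.comp (continuous_fst.comp continuous_subtype_val)

theorem classGroup_mk_eq_one_iff (I : IdealGroup F) :
    ClassGroup.mk F I = 1 ↔ ∃ α : Fˣ, toPrincipalIdeal (𝓞 F) F α = I := by
  rw [← (ClassGroup.equiv F).injective.eq_iff, map_one, ClassGroup.equiv_mk,
    QuotientGroup.mk'_apply, QuotientGroup.eq_one_iff, FractionalIdeal.canonicalEquiv_self]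
  rfl

variable (F) in
/-- The projection of the Arakelov class group to the ideal class group. -/
noncomputable def picToClass : PicZero F →* ClassGroup (𝓞 F) :=
  (picMk F).liftOfSurjective (picMk_surjective F)
    ⟨(ClassGroup.mk F).comp ((MonoidHom.fst _ _).comp (picDom F).subtype), fun x hx => by
      obtain ⟨α, c, -, hx⟩ := (picMk_eq_one_iff x).1 hx
      exact (classGroup_mk_eq_one_iff _).2 ⟨α, (congrArg Prod.fst hx).symm⟩⟩

theorem picToClass_picMk (x : picDom F) : picToClass F (picMk F x) = ClassGroup.mk F x.1.1 :=
  MonoidHom.liftOfRightInverse_comp_apply _ _ _ _ x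

theorem picToClass_archClass (b : (absNormFR F).ker) : picToClass F (archClass F b) = 1 :=
  (picToClass_picMk _).trans (map_one _)

theorem exists_archClass_eq {z : PicZero F} (hz : picToClass F z = 1) :
    ∃ b, archClass F b = z := by
  obtain ⟨x, rfl⟩ := picMk_surjective F z
  rw [picToClass_picMk, classGroup_mk_eq_one_iff] at hz
  obtain ⟨α, hα⟩ := hz
  let p : picDom F := ⟨_, principalHom_mem_picDom α⟩
  obtain ⟨b, hb⟩ := exists_archDom_eq (x := x * p⁻¹) (by
    change x.1.1 * (toPrincipalIdeal (𝓞 F) F α)⁻¹ = 1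
    rw [hα, mul_inv_cancel])
  refine ⟨b, ?_⟩
  have hp : picMk F p = 1 := (picMk_eq_one_iff p).2 ⟨α, 1, one_mem _, by rw [mul_one]⟩
  change picMk F (archDom F b) = _
  rw [hb, map_mul, map_inv, hp, inv_one, mul_one]

theorem exists_picDom_of_ideal (I : IdealGroup F) : ∃ x : picDom F, x.1.1 = I := by
  let N : ℝ := (FractionalIdeal.absNorm (I : FractionalIdeal (𝓞 F)⁰ F) : ℝ)
  have hN0 : 0 ≤ N := Rat.cast_nonneg.2 (FractionalIdeal.absNorm_nonneg _)
  have hN : N ≠ 0 := (idealNormHom F I).ne_zero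
  let n := Module.finrank ℝ (FReal F)
  have hn : n ≠ 0 := Module.finrank_pos.ne'
  let r : ℝ := N ^ (n : ℝ)⁻¹
  have hr : r ^ n = N := Real.rpow_inv_natCast_pow hN0 hn
  have hr0 : r ≠ 0 := fun h => hN (by rw [← hr, h, zero_pow hn])
  let b : (FReal F)ˣ := Units.map (algebraMap ℝ (FReal F)).toMonoidHom (Units.mk0 r hr0)
  refine ⟨⟨(I, b), (mem_picDom_iff _).2 (Units.ext ?_)⟩, rfl⟩
  change N = |Algebra.norm ℝ (algebraMap ℝ (FReal F) r)|
  rw [Algebra.norm_algebraMap, hr, abs_of_nonneg hN0]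

theorem picToClass_surjective : Function.Surjective (picToClass F) := by
  intro c
  obtain ⟨I, rfl⟩ := ClassGroup.mk0_surjective c
  obtain ⟨x, hx⟩ := exists_picDom_of_ideal (FractionalIdeal.mk0 F I)
  exact ⟨picMk F x, by rw [picToClass_picMk, hx, ClassGroup.mk_mk0]⟩

theorem exists_integral_representative (z : PicZero F) :
    ∃ x : picDom F, picMk F x = z ∧ ∃ I : (Ideal (𝓞 F))⁰, x.1.1 = FractionalIdeal.mk0 F I := by
  obtain ⟨x, rfl⟩ := picMk_surjective F z
  obtain ⟨I, hI⟩ := ClassGroup.mk0_surjective (ClassGroup.mk F x.1.1)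
  rw [← ClassGroup.mk_mk0 F, eq_comm, ← div_eq_one, ← map_div, classGroup_mk_eq_one_iff] at hI
  obtain ⟨α, hα⟩ := hI
  let p : picDom F := ⟨_, principalHom_mem_picDom α⟩
  have hp : picMk F p = 1 := (picMk_eq_one_iff p).2 ⟨α, 1, one_mem _, by rw [mul_one]⟩
  refine ⟨x * p⁻¹, by rw [map_mul, map_inv, hp, inv_one, mul_one], I, ?_⟩
  change x.1.1 * (toPrincipalIdeal (𝓞 F) F α)⁻¹ = _
  rw [hα]
  simp

end ArakelovClassGroup

section ArakelovDual

open NumberField.InfinitePlace NumberField.mixedEmbedding NumberField.Units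
  NumberField.Units.dirichletUnitTheorem

variable {F : Type} [Field F] [NumberField F]

theorem ArF.ext {φ ψ : ArF F} (h : ∀ z : PicZero F, φ (.ofMul z) = ψ (.ofMul z)) : φ = ψ :=
  ContinuousAddMonoidHom.ext (A := Additive (PicZero F)) h

theorem ArF.add_apply (φ ψ : ArF F) (z : Additive (PicZero F)) : (φ + ψ) z = φ z + ψ z := rfl

theorem ArF.zero_apply (z : Additive (PicZero F)) : (0 : ArF F) z = 0 := rfl

/-- A character of the Arakelov class group as a homomorphism of groups. -/
def ArF.toHom (φ : ArF F) : Additive (PicZero F) →+ RmodZ :=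
  ContinuousAddMonoidHom.toAddMonoidHom φ

theorem ArF.continuous (φ : ArF F) : Continuous fun z : PicZero F => φ (.ofMul z) :=
  ContinuousAddMonoidHom.continuous_toFun φ

/-- A character of the Arakelov class group from a homomorphism which is continuous on
oriented Arakelov divisors. -/
def ArF.mk (f : Additive (PicZero F) →+ RmodZ)
    (hf : Continuous fun x : picDom F => f (.ofMul (picMk F x))) : ArF F :=
  (⟨f, (isQuotientMap_picMk F).continuous_iff.2 hf⟩ :
    ContinuousAddMonoidHom (Additive (PicZero F)) RmodZ)

/-- The linear form `l` on the logarithmic space describes the restriction of the character `φ`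
to the archimedean part of the Arakelov class group. -/
def ArF.HasLogForm (φ : ArF F) (l : logSpace F →ₗ[ℝ] ℝ) : Prop :=
  ∀ b : (absNormFR F).ker, φ (.ofMul (archClass F b)) = (l (resLog F (.ofMul b.1)) : RmodZ)

theorem ArF.exists_hasLogForm (φ : ArF F) : ∃ l, φ.HasLogForm l := by
  classical
  let f : logSpace F →+ RmodZ :=
    φ.toHom.comp ((MonoidHom.toAdditive (archClass F)).comp (expKer F))
  obtain ⟨l, hl⟩ := exists_linear_lift f (φ.continuous.comp continuous_archClass_expKer)
  refine ⟨l, fun b => ?_⟩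
  have h := hl (resLog F (.ofMul b.1))
  refine Eq.trans ?_ h.symm
  change φ _ = φ (.ofMul (archClass F (expKer F _).toMul))
  rw [archClass_eq_of_resLog (resLog_expKer _)]

theorem ArF.HasLogForm.apply_expKer {φ : ArF F} {l : logSpace F →ₗ[ℝ] ℝ} (h : φ.HasLogForm l)
    (v : logSpace F) : φ (.ofMul (archClass F (expKer F v).toMul)) = (l v : RmodZ) := by
  rw [h, resLog_expKer]

theorem ArF.HasLogForm.eq {φ : ArF F} {l m : logSpace F →ₗ[ℝ] ℝ} (hl : φ.HasLogForm l)
    (hm : φ.HasLogForm m) : l = m := by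
  ext v
  rw [← sub_eq_zero]
  refine eq_zero_of_forall_mul_int fun t => ?_
  have h := (hl.apply_expKer (t • v)).symm.trans (hm.apply_expKer (t • v))
  rw [map_smul, map_smul, smul_eq_mul, smul_eq_mul] at h
  rw [mul_sub, AddCircle.coe_sub, h, sub_self]

theorem ArF.HasLogForm.add {φ ψ : ArF F} {l m : logSpace F →ₗ[ℝ] ℝ} (hl : φ.HasLogForm l)
    (hm : ψ.HasLogForm m) : (φ + ψ).HasLogForm (l + m) := fun b => by
  rw [ArF.add_apply, hl, hm, LinearMap.add_apply, AddCircle.coe_add]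

theorem ArF.HasLogForm.exists_int {φ : ArF F} {l : logSpace F →ₗ[ℝ] ℝ} (hl : φ.HasLogForm l)
    (u : (𝓞 F)ˣ) : ∃ n : ℤ, (n : ℝ) = l (logEmbedding F (.ofMul u)) := by
  have h := hl ⟨_, unitToFReal_mem_ker u⟩
  rw [archClass_unit, resLog_unit] at h
  have h0 : ((l (logEmbedding F (.ofMul u)) : ℝ) : RmodZ) = 0 :=
    h.symm.trans (map_zero φ.toHom)
  obtain ⟨n, hn⟩ := (AddCircle.coe_eq_zero_iff 1).1 h0
  exact ⟨n, by simpa using hn⟩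

theorem ArF.exists_restriction (φ : ArF F) :
    ∃ f : Additive ((𝓞 F)ˣ ⧸ CommGroup.torsion (𝓞 F)ˣ) →+ ℤ, ∃ l, φ.HasLogForm l ∧
      ∀ u : (𝓞 F)ˣ, (f (.ofMul (QuotientGroup.mk u)) : ℝ) = l (logEmbedding F (.ofMul u)) := by
  obtain ⟨l, hl⟩ := φ.exists_hasLogForm
  have key : ∀ x, ∃ n : ℤ, (n : ℝ) = l (unitsModTorsionLog F x) := fun x => by
    obtain ⟨u, hu⟩ := QuotientGroup.mk_surjective x.toMul
    obtain rfl : Additive.ofMul (QuotientGroup.mk u) = x := congrArg Additive.ofMul hu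
    exact hl.exists_int u
  choose f hf using key
  refine ⟨AddMonoidHom.mk' f fun x y => Int.cast_injective (α := ℝ) ?_, l, hl, fun u => hf _⟩
  rw [Int.cast_add, hf, hf, hf, map_add, map_add]

/-- The homomorphism on units modulo torsion obtained by restricting a character of the Arakelov
class group to the archimedean part. -/
noncomputable def ArF.restriction :
    ArF F →+ (Additive ((𝓞 F)ˣ ⧸ CommGroup.torsion (𝓞 F)ˣ) →ₗ[ℤ] ℤ) :=
  AddMonoidHom.mk' (fun φ => φ.exists_restriction.choose.toIntLinearMap) fun φ ψ => by
    obtain ⟨l, hl, h1⟩ := φ.exists_restriction.choose_spec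
    obtain ⟨m, hm, h2⟩ := ψ.exists_restriction.choose_spec
    obtain ⟨p, hp, h3⟩ := (φ + ψ).exists_restriction.choose_spec
    ext x
    obtain ⟨u, hu⟩ := QuotientGroup.mk_surjective x.toMul
    obtain rfl : Additive.ofMul (QuotientGroup.mk u) = x := congrArg Additive.ofMul hu
    refine Int.cast_injective (α := ℝ) ((h3 u).trans ?_)
    rw [hp.eq (hl.add hm), LinearMap.add_apply, ← h1, ← h2, ← Int.cast_add]
    rfl

theorem ArF.HasLogForm.restriction_apply {φ : ArF F} {l : logSpace F →ₗ[ℝ] ℝ}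
    (hl : φ.HasLogForm l) (u : (𝓞 F)ˣ) :
    (ArF.restriction φ (.ofMul (QuotientGroup.mk u)) : ℝ) = l (logEmbedding F (.ofMul u)) := by
  obtain ⟨m, hm, h⟩ := φ.exists_restriction.choose_spec
  rw [hl.eq hm]
  exact h u

theorem ArF.restriction_surjective : Function.Surjective (ArF.restriction (F := F)) := by
  classical
  intro f
  obtain ⟨l, hl⟩ := exists_linear_extension f
  let ψ : Additive (absNormFR F).ker →+ RmodZ :=
    ((QuotientAddGroup.mk' _).comp l.toAddMonoidHom).comp
      ((resLog F).comp (MonoidHom.toAdditive (absNormFR F).ker.subtype))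
  have hψ : ∀ b : (absNormFR F).ker, ψ (.ofMul b) = (l (resLog F (.ofMul b.1)) : RmodZ) :=
    fun _ => rfl
  obtain ⟨χ, hχ⟩ := exists_extension_of_divisible (MonoidHom.toAdditive (archClass F)) ψ (by
    intro b hb
    obtain ⟨u, hu⟩ := exists_unit_of_archClass_eq_one (b := b.toMul) hb
    refine (hψ b.toMul).trans ?_
    rw [hu, hl]
    exact (AddCircle.coe_eq_zero_iff 1).2 ⟨_, by rw [zsmul_one]⟩)
  have hlc : Continuous fun x : picDom F => ((l (resLog F (.ofMul x.1.2)) : ℝ) : RmodZ) := by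
    have hl2 : Continuous l := LinearMap.continuous_of_finiteDimensional l
    exact (AddCircle.continuous_mk' 1).comp
      (hl2.comp (continuous_resLog.comp (continuous_snd.comp continuous_subtype_val)))
  have hcont : Continuous fun x : picDom F => χ (.ofMul (picMk F x)) := by
    have h : Continuous fun x : picDom F =>
        χ (.ofMul (picMk F x)) - ((l (resLog F (.ofMul x.1.2)) : ℝ) : RmodZ) := by
      refine continuous_of_ideal fun x y hxy => ?_
      obtain ⟨b, hb⟩ := exists_archDom_eq (x := x / y) (by
        change x.1.1 / y.1.1 = 1
        rw [hxy, div_self'])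
      have h1 : χ (.ofMul (archClass F b)) = _ := (hχ (.ofMul b)).trans (hψ b)
      have h2 : archClass F b = picMk F x / picMk F y := by
        rw [← map_div, ← hb]
        rfl
      have h3 : b.1 = x.1.2 / y.1.2 := congrArg (fun z : picDom F => z.1.2) hb
      rw [h2, h3, ofMul_div, map_sub, ofMul_div, map_sub, map_sub, AddCircle.coe_sub] at h1
      exact sub_eq_sub_iff_sub_eq_sub.2 h1
    exact (h.add hlc).congr fun x => sub_add_cancel _ _
  have hform : (ArF.mk χ hcont).HasLogForm l := fun b => (hχ (.ofMul b)).trans (hψ b)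
  refine ⟨ArF.mk χ hcont, ?_⟩
  ext x
  obtain ⟨u, hu⟩ := QuotientGroup.mk_surjective x.toMul
  obtain rfl : Additive.ofMul (QuotientGroup.mk u) = x := congrArg Additive.ofMul hu
  exact Int.cast_injective (α := ℝ) ((hform.restriction_apply u).trans (hl u))

/-- The inflation of a character of the class group to the Arakelov class group. -/
noncomputable def ArF.inflation : (Additive (ClassGroup (𝓞 F)) →ₗ[ℤ] QmodZ) →+ ArF F :=
  AddMonoidHom.mk' (fun χ => ArF.mk
    ((qmodzToRmodZ.comp χ).toAddMonoidHom.comp (MonoidHom.toAdditive (picToClass F)))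
    (continuous_of_ideal fun x y hxy => by
      change qmodzToRmodZ (χ (.ofMul (picToClass F (picMk F x)))) =
        qmodzToRmodZ (χ (.ofMul (picToClass F (picMk F y))))
      rw [picToClass_picMk, picToClass_picMk, hxy])) fun χ χ' => ArF.ext fun z =>
        map_add qmodzToRmodZ _ _

theorem ArF.inflation_apply (χ : Additive (ClassGroup (𝓞 F)) →ₗ[ℤ] QmodZ) (z : PicZero F) :
    ArF.inflation χ (.ofMul z) = qmodzToRmodZ (χ (.ofMul (picToClass F z))) := rfl

theorem ArF.inflation_injective : Function.Injective (ArF.inflation (F := F)) := by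
  intro χ χ' h
  ext c
  obtain ⟨z, hz⟩ := picToClass_surjective c.toMul
  obtain rfl : Additive.ofMul (picToClass F z) = c := congrArg Additive.ofMul hz
  apply qmodzToRmodZ_injective
  rw [← ArF.inflation_apply, ← ArF.inflation_apply, h]

theorem ArF.inflation_hasLogForm (χ : Additive (ClassGroup (𝓞 F)) →ₗ[ℤ] QmodZ) :
    (ArF.inflation χ).HasLogForm 0 := fun b => by
  rw [ArF.inflation_apply, picToClass_archClass, ofMul_one, map_zero, map_zero]
  rfl

theorem ArF.exact_inflation_restriction :
    Function.Exact (ArF.inflation (F := F)) (ArF.restriction (F := F)) := by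
  classical
  intro φ
  constructor
  · intro h
    obtain ⟨l, hl⟩ := φ.exists_hasLogForm
    have hl0 : l = 0 := by
      refine LinearMap.ext_on_range (v := ((↑) : unitLattice F → logSpace F)) ?_ ?_
      · rw [Subtype.range_coe]
        exact unitLattice_span_eq_top F
      · rintro ⟨_, u, -, rfl⟩
        have := hl.restriction_apply u.toMul
        rw [h, LinearMap.zero_apply, Int.cast_zero] at this
        exact this.symm
    subst hl0
    have hker : (MonoidHom.toAdditive (picToClass F)).ker ≤ φ.toHom.ker := by
      intro z hz
      obtain ⟨b, hb⟩ := exists_archClass_eq (z := z.toMul) hz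
      refine (congrArg φ (congrArg Additive.ofMul hb)).symm.trans ?_
      exact hl b
    obtain ⟨f, hf⟩ := exists_extension_of_divisible _ _ hker
    obtain ⟨χ, hχ⟩ := exists_lift_qmodz f
    exact ⟨χ, ArF.ext fun z => (hχ _).trans (hf (.ofMul z))⟩
  · rintro ⟨χ, rfl⟩
    ext x
    obtain ⟨u, hu⟩ := QuotientGroup.mk_surjective x.toMul
    obtain rfl : Additive.ofMul (QuotientGroup.mk u) = x := congrArg Additive.ofMul hu
    refine Int.cast_injective (α := ℝ)
      (((ArF.inflation_hasLogForm χ).restriction_apply u).trans ?_)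
    simp

end ArakelovDual

section GaloisAction

open NumberField.InfinitePlace NumberField.mixedEmbedding NumberField.Units
  NumberField.Units.dirichletUnitTheorem

variable {K F : Type} [Field K] [Field F] [Algebra K F]

theorem exists_algebraMap_eq_of_galois (g : F ≃ₐ[K] F) (r : 𝓞 F) :
    ∃ s : 𝓞 F, algebraMap (𝓞 F) F s = g (algebraMap (𝓞 F) F r) :=
  ⟨⟨g r, r.2.map (g.toRingEquiv.toRingHom.toIntAlgHom)⟩, rfl⟩

theorem exists_unit_eq_of_galois (g : F ≃ₐ[K] F) (u : (𝓞 F)ˣ) :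
    ∃ v : (𝓞 F)ˣ, ((v : 𝓞 F) : F) = g ((u : 𝓞 F) : F) := by
  obtain ⟨r, hr⟩ := exists_algebraMap_eq_of_galois g (u : 𝓞 F)
  obtain ⟨s, hs⟩ := exists_algebraMap_eq_of_galois g ((u⁻¹ : (𝓞 F)ˣ) : 𝓞 F)
  have hrs : r * s = 1 := by
    apply RingOfIntegers.coe_injective
    rw [map_mul, map_one, hr, hs, ← map_mul, ← map_mul, Units.mul_inv, map_one, map_one]
  exact ⟨⟨r, s, hrs, by rw [mul_comm, hrs]⟩, hr⟩

theorem mult_comap_galois (g : F ≃ₐ[K] F) (w : InfinitePlace F) :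
    (w.comap (g : F →+* F)).mult = w.mult := by
  have h : (w.comap (g : F →+* F)).IsReal ↔ w.IsReal := isReal_comap_iff g.toRingEquiv
  classical
  exact if_congr h rfl rfl

variable [NumberField K] [NumberField F]

/-- The Galois action on oriented Arakelov divisors, as a relation. -/
def IsGaloisTranslate (g : F ≃ₐ[K] F) (x y : picDom F) : Prop :=
  ((((y.1.1 : FractionalIdeal (𝓞 F)⁰ F) : Submodule (𝓞 F) F) : Set F) =
    g '' (((x.1.1 : FractionalIdeal (𝓞 F)⁰ F) : Submodule (𝓞 F) F) : Set F)) ∧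
  ((y.1.2 : FReal F) = galFReal K g (x.1.2 : FReal F))

/-- Galois translates of integral ideals are integral. -/
theorem IsGaloisTranslate.exists_ideal {g : F ≃ₐ[K] F} {x y : picDom F}
    (h : IsGaloisTranslate g x y) {I : (Ideal (𝓞 F))⁰} (hI : x.1.1 = FractionalIdeal.mk0 F I) :
    ∃ J : (Ideal (𝓞 F))⁰, y.1.1 = FractionalIdeal.mk0 F J ∧
      algebraMap (𝓞 F) F '' ((J : Ideal (𝓞 F)) : Set (𝓞 F)) =
        g '' (algebraMap (𝓞 F) F '' ((I : Ideal (𝓞 F)) : Set (𝓞 F))) := by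
  have hcoe : ∀ J : Ideal (𝓞 F), (((J : FractionalIdeal (𝓞 F)⁰ F) : Submodule (𝓞 F) F) : Set F) =
      algebraMap (𝓞 F) F '' (J : Set (𝓞 F)) := fun J => by
    ext a
    exact FractionalIdeal.mem_coeIdeal _
  have h1 := h.1
  rw [hI, FractionalIdeal.coe_mk0, hcoe] at h1
  have hle : (y.1.1 : FractionalIdeal (𝓞 F)⁰ F) ≤ 1 := by
    intro a ha
    have ha' : a ∈ g '' (algebraMap (𝓞 F) F '' ((I : Ideal (𝓞 F)) : Set (𝓞 F))) := h1 ▸ ha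
    obtain ⟨_, ⟨r, -, rfl⟩, rfl⟩ := ha'
    exact (FractionalIdeal.mem_one_iff _).2 (exists_algebraMap_eq_of_galois g r)
  obtain ⟨J, hJ⟩ := FractionalIdeal.le_one_iff_exists_coeIdeal.1 hle
  have hJ0 : J ≠ 0 := by
    rintro rfl
    exact y.1.1.ne_zero (hJ.symm.trans FractionalIdeal.coeIdeal_bot)
  refine ⟨⟨J, mem_nonZeroDivisors_of_ne_zero hJ0⟩, Units.ext hJ.symm, ?_⟩
  rw [← h1, ← hJ, hcoe]

/-- The Galois translate of an archimedean divisor is archimedean. -/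
theorem IsGaloisTranslate.exists_arch {g : F ≃ₐ[K] F} {b : (absNormFR F).ker} {y : picDom F}
    (h : IsGaloisTranslate g (archDom F b) y) :
    ∃ c : (absNormFR F).ker, archDom F c = y ∧
      ((c : (FReal F)ˣ) : FReal F) = galFReal K g ((b : (FReal F)ˣ) : FReal F) := by
  have hy : y.1.1 = 1 := by
    obtain ⟨J, hJ, hJ2⟩ := h.exists_ideal (I := 1) (by rw [map_one, archDom_fst])
    have h1 : (J : Ideal (𝓞 F)) = 1 := by
      rw [Ideal.one_eq_top, Ideal.eq_top_iff_one]
      have : (1 : F) ∈ g '' (algebraMap (𝓞 F) F '' (((1 : (Ideal (𝓞 F))⁰) : Ideal (𝓞 F)) :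
          Set (𝓞 F))) := ⟨1, ⟨1, by simp, map_one _⟩, map_one g⟩
      rw [← hJ2] at this
      obtain ⟨r, hr, hr1⟩ := this
      rwa [RingOfIntegers.coe_injective (hr1.trans (map_one (algebraMap (𝓞 F) F)).symm)] at hr
    rw [hJ, show J = 1 from Subtype.ext h1, map_one]
  obtain ⟨c, rfl⟩ := exists_archDom_eq hy
  exact ⟨c, rfl, h.2⟩

theorem placeLog_of_galois {g : F ≃ₐ[K] F} {b c : (FReal F)ˣ}
    (h : (c : FReal F) = galFReal K g (b : FReal F)) (w : InfinitePlace F) :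
    placeLog F (.ofMul c) w = placeLog F (.ofMul b) (w.comap (g : F →+* F)) := by
  rw [placeLog_apply, placeLog_apply, h, normAtPlace_galFReal]
  rw [mult_comap_galois]

/-- The restriction of characters to units is compatible with Galois translation. -/
theorem restriction_of_galois {g : F ≃ₐ[K] F} {φ ψ : ArF F}
    (h : ∀ x : picDom F, ∃ y, IsGaloisTranslate g x y ∧
      ψ (.ofMul (picMk F x)) = φ (.ofMul (picMk F y))) {u v : (𝓞 F)ˣ}
    (huv : ((v : 𝓞 F) : F) = g ((u : 𝓞 F) : F)) :
    ArF.restriction ψ (.ofMul (QuotientGroup.mk u)) =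
      ArF.restriction φ (.ofMul (QuotientGroup.mk v)) := by
  obtain ⟨l, hl⟩ := φ.exists_hasLogForm
  obtain ⟨m, hm⟩ := ψ.exists_hasLogForm
  apply Int.cast_injective (α := ℝ)
  rw [hl.restriction_apply, hm.restriction_apply, ← sub_eq_zero]
  refine eq_zero_of_forall_mul_int fun t => ?_
  let w := logEmbedding F (.ofMul u)
  let b := (expKer F (t • w)).toMul
  obtain ⟨y, hy, hψ⟩ := h (archDom F b)
  obtain ⟨c, rfl, hc⟩ := hy.exists_arch
  have hcw : resLog F (.ofMul c.1) = t • logEmbedding F (.ofMul v) := by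
    ext i
    have hb : placeLog F (.ofMul b.1) =
        t • placeLog F (.ofMul (unitToFReal F (Units.map (algebraMap (𝓞 F) F).toMonoidHom u))) := by
      rw [placeLog_expKer, ← extendLog_resLog (unitToFReal_mem_ker u), resLog_unit, map_smul]
    rw [resLog_apply, placeLog_of_galois hc, hb, Pi.smul_apply, Pi.smul_apply, ← resLog_unit,
      resLog_apply, placeLog_unitToFReal, placeLog_unitToFReal]
    have hval : ((Units.map (algebraMap (𝓞 F) F).toMonoidHom v : Fˣ) : F) =
        g (Units.map (algebraMap (𝓞 F) F).toMonoidHom u : Fˣ) := huv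
    rw [hval, mult_comap_galois]
    rfl
  have h1 := (hm.apply_expKer (t • w)).symm.trans (hψ.trans (hl c))
  rw [hcw, map_smul, map_smul, smul_eq_mul, smul_eq_mul] at h1
  rw [mul_sub, AddCircle.coe_sub, h1, sub_self]

/-- The projection to the class group is compatible with Galois translation. -/
theorem picToClass_of_galois {G : Type} [Group G] (iso : G ≃* (F ≃ₐ[K] F))
    {ρ : G → PicZero F → PicZero F}
    (hρ : ∀ (g : G) (x : picDom F), ∃ y, IsGaloisTranslate (iso g) x y ∧
      ρ g (PicZero.mk F x) = PicZero.mk F y)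
    [Module (MonoidAlgebra ℤ G) (Additive (ClassGroup (𝓞 F)))]
    (hmCl : ∀ (g : G) (I J : (Ideal (𝓞 F))⁰),
      (algebraMap (𝓞 F) F '' ((J : Ideal (𝓞 F)) : Set (𝓞 F)) =
        iso g '' (algebraMap (𝓞 F) F '' ((I : Ideal (𝓞 F)) : Set (𝓞 F)))) →
      (MonoidAlgebra.single g (1 : ℤ) : MonoidAlgebra ℤ G) •
          Additive.ofMul (ClassGroup.mk0 I) = Additive.ofMul (ClassGroup.mk0 J))
    (g : G) (z : PicZero F) :
    Additive.ofMul (picToClass F (ρ g z)) =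
      (MonoidAlgebra.single g (1 : ℤ) : MonoidAlgebra ℤ G) • Additive.ofMul (picToClass F z) := by
  obtain ⟨x, rfl, I, hI⟩ := exists_integral_representative z
  obtain ⟨y, hy, hρy⟩ := hρ g x
  obtain ⟨J, hJ, hIJ⟩ := hy.exists_ideal hI
  have h : ρ g (picMk F x) = picMk F y := hρy
  rw [h, picToClass_picMk, picToClass_picMk, hI, hJ, ClassGroup.mk_mk0, ClassGroup.mk_mk0,
    hmCl g I J hIJ]

end GaloisAction
/-!
STATEMENT 13: Let F/K be a finite Galois extension of number fields with Galois group G,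
let μ_F be the group of roots of unity of F, and let Cl_F be the ideal class group of O_F.
Then the equality [Ar_F] = σ[O_F^×/μ_F] − σ[Cl_F] holds in G₀(ℤ[G]).

Here `Ar_F` is the Pontryagin dual of the Arakelov class group `Pic⁰_F` constructed above,
a ℤ[G]-module via the involution g ↦ g⁻¹; all ℤ[G]-module structures and the Galois
action are universally quantified and pinned down by pointwise characterizations, and
σ is characterized by its effect on lattices (σ[M] = [Hom_ℤ(M,ℤ)]) and on finite modules
(σ[N] = −[Hom_ℤ(N,ℚ/ℤ)]).
-/
theorem stmt13
    (K F : Type) [Field K] [NumberField K] [Field F] [NumberField F] [Algebra K F]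
    [IsGalois K F] (G : Type) [Group G] (iso : G ≃* (F ≃ₐ[K] F))
    -- the Galois action of G on the Arakelov class group, characterized on classes
    -- of oriented Arakelov divisors (I, b) via the action on the underlying ideals and on F_ℝ
    (ρ0 : G → PicZero F → PicZero F)
    (hρ0 : ∀ (g : G) (x : picDom F), ∃ y : picDom F,
      ((((((y : IdealGroup F × (FReal F)ˣ).1 : FractionalIdeal (𝓞 F)⁰ F) :
          Submodule (𝓞 F) F) : Set F)) =
        (iso g) '' (((((x : IdealGroup F × (FReal F)ˣ).1 : FractionalIdeal (𝓞 F)⁰ F) :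
          Submodule (𝓞 F) F) : Set F))) ∧
      (((y : IdealGroup F × (FReal F)ˣ).2 : FReal F) =
        galFReal K (iso g) ((x : IdealGroup F × (FReal F)ˣ).2 : FReal F)) ∧
      ρ0 g (PicZero.mk F x) = PicZero.mk F y)
    -- the ℤ[G]-module structure on the Pontryagin dual (G acting via g ↦ g⁻¹)
    [mAr : Module (MonoidAlgebra ℤ G) (ArF F)]
    (hmAr : ∀ (g : G) (φ : ArF F) (z : PicZero F),
      ((MonoidAlgebra.single g (1 : ℤ) : MonoidAlgebra ℤ G) • φ) (Additive.ofMul z) =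
        φ (Additive.ofMul (ρ0 g⁻¹ z)))
    -- the ℤ[G]-module O_F^×/μ_F
    [mU : Module (MonoidAlgebra ℤ G) (Additive ((𝓞 F)ˣ ⧸ CommGroup.torsion (𝓞 F)ˣ))]
    (hmU : ∀ (g : G) (u v : (𝓞 F)ˣ), ((v : 𝓞 F) : F) = iso g ((u : 𝓞 F) : F) →
      (MonoidAlgebra.single g (1 : ℤ) : MonoidAlgebra ℤ G) •
          Additive.ofMul (QuotientGroup.mk u : (𝓞 F)ˣ ⧸ CommGroup.torsion (𝓞 F)ˣ) =
        Additive.ofMul (QuotientGroup.mk v : (𝓞 F)ˣ ⧸ CommGroup.torsion (𝓞 F)ˣ))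
    -- the ℤ[G]-module Cl_F, characterized on classes of nonzero ideals of O_F
    [mCl : Module (MonoidAlgebra ℤ G) (Additive (ClassGroup (𝓞 F)))]
    (hmCl : ∀ (g : G) (I J : (Ideal (𝓞 F))⁰),
      (algebraMap (𝓞 F) F '' ((J : Ideal (𝓞 F)) : Set (𝓞 F)) =
        iso g '' (algebraMap (𝓞 F) F '' ((I : Ideal (𝓞 F)) : Set (𝓞 F)))) →
      (MonoidAlgebra.single g (1 : ℤ) : MonoidAlgebra ℤ G) •
          Additive.ofMul (ClassGroup.mk0 I) = Additive.ofMul (ClassGroup.mk0 J))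
    -- σ : the duality endomorphism of G₀(ℤ[G]) induced by M ↦ Hom_ℤ(M,ℤ) on lattices
    -- (with G acting via the involution g ↦ g⁻¹); on a finite module N it satisfies
    -- σ[N] = −[Hom_ℤ(N, ℚ/ℤ)]
    (σ : G0 (MonoidAlgebra ℤ G) →+ G0 (MonoidAlgebra ℤ G))
    (hσlat : ∀ (M : Type) [AddCommGroup M] [Module (MonoidAlgebra ℤ G) M]
        [Module.Finite (MonoidAlgebra ℤ G) M] [Module.Projective ℤ M]
        [Module (MonoidAlgebra ℤ G) (M →ₗ[ℤ] ℤ)],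
      (∀ (g : G) (φ : M →ₗ[ℤ] ℤ) (x : M),
        ((MonoidAlgebra.single g (1 : ℤ) : MonoidAlgebra ℤ G) • φ) x =
          φ ((MonoidAlgebra.single g⁻¹ (1 : ℤ) : MonoidAlgebra ℤ G) • x)) →
      σ (G0.cls (MonoidAlgebra ℤ G) M) = G0.cls (MonoidAlgebra ℤ G) (M →ₗ[ℤ] ℤ))
    (hσtor : ∀ (N : Type) [AddCommGroup N] [Module (MonoidAlgebra ℤ G) N]
        [Module (MonoidAlgebra ℤ G) (N →ₗ[ℤ] QmodZ)], Finite N →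
      (∀ (g : G) (φ : N →ₗ[ℤ] QmodZ) (x : N),
        ((MonoidAlgebra.single g (1 : ℤ) : MonoidAlgebra ℤ G) • φ) x =
          φ ((MonoidAlgebra.single g⁻¹ (1 : ℤ) : MonoidAlgebra ℤ G) • x)) →
      σ (G0.cls (MonoidAlgebra ℤ G) N) = - G0.cls (MonoidAlgebra ℤ G) (N →ₗ[ℤ] QmodZ))
 :
    G0.cls (MonoidAlgebra ℤ G) (ArF F) =
      σ (G0.cls (MonoidAlgebra ℤ G) (Additive ((𝓞 F)ˣ ⧸ CommGroup.torsion (𝓞 F)ˣ))) -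
        σ (G0.cls (MonoidAlgebra ℤ G) (Additive (ClassGroup (𝓞 F)))) := by
  have hρ : ∀ (g : G) (x : picDom F), ∃ y, IsGaloisTranslate (iso g) x y ∧
      ρ0 g (PicZero.mk F x) = PicZero.mk F y := fun g x => by
    obtain ⟨y, h1, h2, h3⟩ := hρ0 g x
    exact ⟨y, ⟨h1, h2⟩, h3⟩
  let : Module (MonoidAlgebra ℤ G)
      (Additive ((𝓞 F)ˣ ⧸ CommGroup.torsion (𝓞 F)ˣ) →ₗ[ℤ] ℤ) := contragredientModule G _ ℤ
  let : Module (MonoidAlgebra ℤ G) (Additive (ClassGroup (𝓞 F)) →ₗ[ℤ] QmodZ) :=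
    contragredientModule G _ QmodZ
  have : Finite (Additive (ClassGroup (𝓞 F))) := inferInstanceAs (Finite (ClassGroup (𝓞 F)))
  have : Module.Finite (MonoidAlgebra ℤ G) (Additive ((𝓞 F)ˣ ⧸ CommGroup.torsion (𝓞 F)ˣ)) :=
    groupRing_finite_of_int
  have : Module.Finite (MonoidAlgebra ℤ G)
      (Additive ((𝓞 F)ˣ ⧸ CommGroup.torsion (𝓞 F)ˣ) →ₗ[ℤ] ℤ) := groupRing_finite_of_int
  rw [hσlat _ (contragredientModule_smul_apply (A := ℤ)),
    hσtor _ inferInstance (contragredientModule_smul_apply (A := QmodZ)), sub_neg_eq_add, add_comm]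
  have hinfl : ∀ (g : G) (χ : Additive (ClassGroup (𝓞 F)) →ₗ[ℤ] QmodZ),
      ArF.inflation ((MonoidAlgebra.single g (1 : ℤ) : MonoidAlgebra ℤ G) • χ) =
        (MonoidAlgebra.single g (1 : ℤ) : MonoidAlgebra ℤ G) • ArF.inflation χ := fun g χ => by
    refine ArF.ext fun z => ?_
    rw [hmAr, ArF.inflation_apply, ArF.inflation_apply, contragredientModule_smul_apply,
      picToClass_of_galois iso hρ hmCl]
  have hres : ∀ (g : G) (φ : ArF F),
      ArF.restriction ((MonoidAlgebra.single g (1 : ℤ) : MonoidAlgebra ℤ G) • φ) =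
        (MonoidAlgebra.single g (1 : ℤ) : MonoidAlgebra ℤ G) • ArF.restriction φ := fun g φ => by
    ext x
    obtain ⟨u, hu⟩ := QuotientGroup.mk_surjective x.toMul
    obtain rfl : Additive.ofMul (QuotientGroup.mk u) = x := congrArg Additive.ofMul hu
    obtain ⟨v, hv⟩ := exists_unit_eq_of_galois (iso g⁻¹) u
    rw [contragredientModule_smul_apply, hmU g⁻¹ u v hv]
    refine restriction_of_galois (fun x => ?_) hv
    obtain ⟨y, hy, hρy⟩ := hρ g⁻¹ x
    refine ⟨y, hy, (hmAr g φ _).trans ?_⟩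
    exact congrArg (fun z => φ (Additive.ofMul z)) hρy
  exact G0.cls_eq_add_of_exact (ArF.inflation.toGroupRingLinearMap hinfl)
    (ArF.restriction.toGroupRingLinearMap hres) ArF.inflation_injective ArF.restriction_surjective
    ArF.exact_inflation_restriction
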